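/- arXiv:1809.00008 — 3 statements merged into one kernel-verified Lean document; each statement's English description precedes it below -/
import Mathlib

section
/- Let p be a prime, k ≥ 2, and D = D_0 ⊆ Z_p^{p^{k-1}} be the dual of the two-weight code P generated by A = (all-ones row; B) with B's columns all vectors of Z_p^{k-1}. Then (1/|D_0|)·W_{D_0}(X + (p−1)Y, X − Y) = X^{p^{k-1}} + (p−1)Y^{p^{k-1}} + (p^k − p)·X^{p^{k-2}}·Y^{(p-1)p^{k-2}}. -/
/-- The dual of a linear code `C ⊆ R^n` under the standard inner product. -/
def dualCode {R : Type*} [CommRing R] {n : ℕ} (C : Submodule R (Fin n → R)) :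
    Submodule R (Fin n → R) where
  carrier := {x | ∀ c ∈ C, ∑ j, x j * c j = 0}
  add_mem' := by
    intro a b ha hb c hc
    simp only [Pi.add_apply, add_mul, Finset.sum_add_distrib, ha c hc, hb c hc, add_zero]
  zero_mem' := by intro c hc; simp
  smul_mem' := by
    intro r a ha c hc
    simp only [Pi.smul_apply, smul_eq_mul, mul_assoc, ← Finset.mul_sum, ha c hc, mul_zero]

/-- Weight factor: `X` at zero and `Y` elsewhere. -/
noncomputable def wfac (p : ℕ) (X Y : ℂ) (a : ZMod p) : ℂ := if a = 0 then X else Y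

lemma prod_wfac {p n : ℕ} (X Y : ℂ) (c : Fin n → ZMod p) :
    ∏ j, wfac p X Y (c j) = X ^ (n - hammingNorm c) * Y ^ hammingNorm c := by
  classical
  unfold wfac
  rw [Finset.prod_ite, Finset.prod_const, Finset.prod_const]
  have h : (Finset.univ.filter (fun j => ¬ c j = 0)).card = hammingNorm c := rfl
  have h2 := Finset.card_filter_add_card_filter_not (s := (Finset.univ : Finset (Fin n)))
    (fun j => c j = 0)
  rw [h] at h2
  rw [h]
  simp only [Finset.card_univ, Fintype.card_fin] at h2
  congr 2
  omega

lemma fourier_wfac {p : ℕ} [Fact p.Prime] (X Y : ℂ) (w : ZMod p) :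
    ∑ a : ZMod p, wfac p (X + (p - 1) * Y) (X - Y) a * ZMod.stdAddChar (a * w)
      = p * wfac p X Y w := by
  classical
  have h1 : ∀ a : ZMod p, wfac p (X + (p - 1) * Y) (X - Y) a * ZMod.stdAddChar (a * w)
      = (X - Y) * ZMod.stdAddChar (a * w) + (if a = 0 then (p : ℂ) * Y else 0) := by
    intro a
    unfold wfac
    split_ifs with h
    · subst h; simp; ring
    · simp
  simp_rw [h1]
  rw [Finset.sum_add_distrib, ← Finset.mul_sum,
    AddChar.sum_mulShift w (ZMod.isPrimitive_stdAddChar p)]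
  unfold wfac
  rw [Finset.sum_ite_eq' Finset.univ (0 : ZMod p)]
  split_ifs with h
  · simp [ZMod.card]; ring
  · simp_all
  · simp
  · simp_all

lemma mem_dual_span {p k n : ℕ} (A : Fin k → Fin n → ZMod p) (c : Fin n → ZMod p) :
    c ∈ dualCode (Submodule.span (ZMod p) (Set.range A)) ↔ ∀ i, ∑ j, c j * A i j = 0 := by
  constructor
  · intro h i
    exact h _ (Submodule.subset_span ⟨i, rfl⟩)
  · intro h x hx
    induction hx using Submodule.span_induction with
    | mem x hx => obtain ⟨i, rfl⟩ := hx; exact h i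
    | zero => simp
    | add x y _ _ h1 h2 => simp [mul_add, Finset.sum_add_distrib, h1, h2]
    | smul r x _ h1 =>
      have : ∀ j, c j * (r • x) j = r * (c j * x j) := by
        intro j; simp; ring
      simp_rw [this]
      rw [← Finset.mul_sum, h1, mul_zero]

lemma stdAddChar_sum {p : ℕ} [NeZero p] {ι : Type*} (s : Finset ι) (f : ι → ZMod p) :
    (ZMod.stdAddChar (∑ i ∈ s, f i) : ℂ) = ∏ i ∈ s, ZMod.stdAddChar (f i) := by
  classical
  induction s using Finset.induction_on with
  | empty => simp
  | insert a s ha ih =>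
    rw [Finset.sum_insert ha, Finset.prod_insert ha, AddChar.map_add_eq_mul, ih]

lemma indicator_sum {p k : ℕ} [Fact p.Prime] (s : Fin k → ZMod p) :
    ∑ u : Fin k → ZMod p, (ZMod.stdAddChar (∑ i, u i * s i) : ℂ)
      = if ∀ i, s i = 0 then (p : ℂ) ^ k else 0 := by
  classical
  have h : ∀ u : Fin k → ZMod p, (ZMod.stdAddChar (∑ i, u i * s i) : ℂ)
      = ∏ i, ZMod.stdAddChar (u i * s i) := by
    intro u
    exact stdAddChar_sum _ _
  simp_rw [h]
  have h2 := Finset.prod_univ_sum (fun _ : Fin k => (Finset.univ : Finset (ZMod p)))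
    (fun i t => (ZMod.stdAddChar (t * s i) : ℂ))
  rw [Fintype.piFinset_univ] at h2
  rw [← h2]
  have h3 : ∀ i, ∑ t : ZMod p, (ZMod.stdAddChar (t * s i) : ℂ) = if s i = 0 then (p : ℂ) else 0 := by
    intro i
    rw [AddChar.sum_mulShift (s i) (ZMod.isPrimitive_stdAddChar p)]
    simp [ZMod.card]
  simp_rw [h3]
  split_ifs with h4
  · simp [h4]
  · push Not at h4
    obtain ⟨i, hi⟩ := h4
    exact Finset.prod_eq_zero (Finset.mem_univ i) (by simp [hi])

open Classical in
lemma macw {p k n : ℕ} [Fact p.Prime] (A : Fin k → Fin n → ZMod p) (X Y : ℂ) :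
    (p : ℂ) ^ k * ∑ c : Fin n → ZMod p,
      (if ∀ i, ∑ j, c j * A i j = 0 then
        ∏ j, wfac p (X + (p - 1) * Y) (X - Y) (c j) else 0)
      = (p : ℂ) ^ n * ∑ u : Fin k → ZMod p, ∏ j, wfac p X Y (∑ i, u i * A i j) := by
  have h1 : ∀ c : Fin n → ZMod p, (p : ℂ) ^ k * (if ∀ i, ∑ j, c j * A i j = 0 then
        ∏ j, wfac p (X + (p - 1) * Y) (X - Y) (c j) else 0)
      = ∑ u : Fin k → ZMod p, ∏ j, (wfac p (X + (p - 1) * Y) (X - Y) (c j) *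
          ZMod.stdAddChar (c j * ∑ i, u i * A i j)) := by
    intro c
    have : ∀ u : Fin k → ZMod p, ∏ j, (wfac p (X + (p - 1) * Y) (X - Y) (c j) *
          (ZMod.stdAddChar (c j * ∑ i, u i * A i j) : ℂ))
        = (∏ j, wfac p (X + (p - 1) * Y) (X - Y) (c j)) *
          ZMod.stdAddChar (∑ i, u i * ∑ j, c j * A i j) := by
      intro u
      rw [Finset.prod_mul_distrib, ← stdAddChar_sum]
      congr 2
      simp_rw [Finset.mul_sum]
      rw [Finset.sum_comm]
      refine Finset.sum_congr rfl fun i _ => Finset.sum_congr rfl fun j _ => by ring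
    simp_rw [this]
    rw [← Finset.mul_sum, indicator_sum]
    split_ifs <;> ring
  rw [Finset.mul_sum]
  simp_rw [h1]
  rw [Finset.sum_comm, Finset.mul_sum]
  refine Finset.sum_congr rfl fun u _ => ?_
  have h2 := Finset.prod_univ_sum (fun _ : Fin n => (Finset.univ : Finset (ZMod p)))
    (fun j t => wfac p (X + (p - 1) * Y) (X - Y) t *
          (ZMod.stdAddChar (t * ∑ i, u i * A i j) : ℂ))
  rw [Fintype.piFinset_univ] at h2
  rw [← h2]
  simp_rw [fourier_wfac]
  rw [Finset.prod_mul_distrib]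
  simp

lemma fiber_card {p m : ℕ} [Fact p.Prime] (v : Fin (m + 1) → ZMod p) (hv : v ≠ 0) (a : ZMod p) :
    (Finset.univ.filter (fun b : Fin (m + 1) → ZMod p => a + ∑ i, v i * b i = 0)).card = p ^ m := by
  classical
  obtain ⟨i, hi⟩ := Function.ne_iff.mp hv
  simp only [Pi.zero_apply] at hi
  have hp := (Fact.out : p.Prime)
  -- the fibre is parametrised by the coordinates other than `i`
  have : (Finset.univ.filter (fun b : Fin (m + 1) → ZMod p => a + ∑ i, v i * b i = 0)).card
      = (Finset.univ : Finset (Fin m → ZMod p)).card := by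
    refine Finset.card_bij' (fun b _ => i.removeNth b)
      (fun c _ => i.insertNth (-(v i)⁻¹ * (a + ∑ l, v (i.succAbove l) * c l)) c) ?_ ?_ ?_ ?_
    · intro b _; simp
    · intro c _
      simp only [Finset.mem_filter, Finset.mem_univ, true_and]
      rw [Fin.sum_univ_succAbove _ i]
      simp only [Fin.insertNth_apply_same, Fin.insertNth_apply_succAbove]
      field_simp
      ring
    · intro b hb
      simp only [Finset.mem_filter, Finset.mem_univ, true_and] at hb
      rw [Fin.sum_univ_succAbove _ i] at hb
      rw [Fin.insertNth_eq_iff]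
      refine ⟨?_, rfl⟩
      simp only [Fin.removeNth]
      field_simp
      linear_combination -hb
    · intro c _
      simp
  rw [this]
  simp [ZMod.card]

lemma sum_formula {p m : ℕ} [Fact p.Prime] (X Y : ℂ) :
    ∑ a : ZMod p, ∑ v : Fin (m + 1) → ZMod p, ∏ b : Fin (m + 1) → ZMod p,
        wfac p X Y (a + ∑ i, v i * b i)
      = X ^ (p ^ (m + 1)) + (p - 1) * Y ^ (p ^ (m + 1))
        + ((p : ℂ) ^ (m + 2) - p) * X ^ (p ^ m) * Y ^ ((p - 1) * p ^ m) := by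
  classical
  have hp := (Fact.out : p.Prime)
  have h1 : ∀ (a : ZMod p) (v : Fin (m + 1) → ZMod p), v ≠ 0 →
      ∏ b : Fin (m + 1) → ZMod p, wfac p X Y (a + ∑ i, v i * b i)
        = X ^ (p ^ m) * Y ^ ((p - 1) * p ^ m) := by
    intro a v hv
    unfold wfac
    rw [Finset.prod_ite, Finset.prod_const, Finset.prod_const, fiber_card v hv a]
    have h2 := Finset.card_filter_add_card_filter_not
      (s := (Finset.univ : Finset (Fin (m + 1) → ZMod p)))
      (fun b => a + ∑ i, v i * b i = 0)
    rw [fiber_card v hv a] at h2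
    simp only [Finset.card_univ, Fintype.card_pi, ZMod.card, Finset.prod_const,
      Fintype.card_fin] at h2
    congr 2
    rw [Nat.sub_mul, one_mul, ← pow_succ']
    omega
  have h0 : ∀ a : ZMod p, ∏ b : Fin (m + 1) → ZMod p,
      wfac p X Y (a + ∑ i, (0 : Fin (m + 1) → ZMod p) i * b i)
      = Y ^ (p ^ (m + 1)) + if a = 0 then X ^ (p ^ (m + 1)) - Y ^ (p ^ (m + 1)) else 0 := by
    intro a
    unfold wfac
    split_ifs with h <;> simp [h, ZMod.card]
  have h3 : ∀ a : ZMod p, ∑ v : Fin (m + 1) → ZMod p, ∏ b : Fin (m + 1) → ZMod p,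
        wfac p X Y (a + ∑ i, v i * b i)
      = (Y ^ (p ^ (m + 1)) + if a = 0 then X ^ (p ^ (m + 1)) - Y ^ (p ^ (m + 1)) else 0)
        + ((p : ℂ) ^ (m + 1) - 1) * (X ^ (p ^ m) * Y ^ ((p - 1) * p ^ m)) := by
    intro a
    rw [← Finset.add_sum_erase _ _ (Finset.mem_univ (0 : Fin (m + 1) → ZMod p)), h0]
    rw [Finset.sum_congr rfl (fun v hv => h1 a v (Finset.ne_of_mem_erase hv))]
    rw [Finset.sum_const, Finset.card_erase_of_mem (Finset.mem_univ _), nsmul_eq_mul,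
      Nat.cast_sub (Finset.card_pos.mpr ⟨0, Finset.mem_univ _⟩)]
    simp [ZMod.card]
  simp_rw [h3]
  rw [Finset.sum_add_distrib, Finset.sum_add_distrib,
    Finset.sum_ite_eq' Finset.univ (0 : ZMod p)]
  simp [ZMod.card]
  ring

lemma sum_code {p m : ℕ} [Fact p.Prime]
    (A : Fin (m + 2) → Fin (p ^ (m + 1)) → ZMod p) (hrow0 : ∀ j, A 0 j = 1)
    (hB : Function.Bijective (fun (j : Fin (p ^ (m + 1))) => fun (i : Fin (m + 1)) => A i.succ j))
    (X Y : ℂ) :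
    ∑ u : Fin (m + 2) → ZMod p, ∏ j, wfac p X Y (∑ i, u i * A i j)
      = X ^ (p ^ (m + 1)) + (p - 1) * Y ^ (p ^ (m + 1))
        + ((p : ℂ) ^ (m + 2) - p) * X ^ (p ^ m) * Y ^ ((p - 1) * p ^ m) := by
  rw [← sum_formula, ← Fintype.sum_prod_type']
  symm
  refine Fintype.sum_equiv (Fin.consEquiv (fun _ : Fin (m + 2) => ZMod p)) _ _ ?_
  rintro ⟨a, v⟩
  symm
  refine Fintype.prod_bijective _ hB _ _ ?_
  intro j
  rw [Fin.sum_univ_succ]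
  simp [hrow0]

open Classical in
lemma finsum_code {p n k : ℕ} [Fact p.Prime] (A : Fin k → Fin n → ZMod p)
    (f : (Fin n → ZMod p) → ℂ) :
    ∑ᶠ c ∈ (dualCode (Submodule.span (ZMod p) (Set.range A)) : Set (Fin n → ZMod p)), f c
      = ∑ c : Fin n → ZMod p, (if ∀ i, ∑ j, c j * A i j = 0 then f c else 0) := by
  rw [finsum_eq_sum_of_fintype]
  refine Finset.sum_congr rfl fun c _ => ?_
  rw [finsum_eq_if]
  simp only [SetLike.mem_coe, mem_dual_span]

/-- MacWilliams-transformed weight enumerator of `D₀ = P^⊥`: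
`(1/|D₀|)·W_{D₀}(X+(p-1)Y, X-Y) = X^{p^{k-1}} + (p-1)Y^{p^{k-1}} + (p^k-p)X^{p^{k-2}}Y^{(p-1)p^{k-2}}`. -/
theorem stmt6 (p k : ℕ) (hp : p.Prime) (hk : 2 ≤ k)
    (A : Fin k → Fin (p ^ (k - 1)) → ZMod p)
    (hrow0 : ∀ j, A ⟨0, by omega⟩ j = 1)
    (hB : Function.Bijective
      (fun (j : Fin (p ^ (k - 1))) => fun (i : Fin (k - 1)) => A ⟨i.val + 1, by omega⟩ j))
    (P : Submodule (ZMod p) (Fin (p ^ (k - 1)) → ZMod p))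
    (hP : P = Submodule.span (ZMod p) (Set.range A))
    (D₀ : Submodule (ZMod p) (Fin (p ^ (k - 1)) → ZMod p))
    (hD : D₀ = dualCode P)
    (X Y : ℂ) :
    (1 / (Nat.card D₀ : ℂ)) *
        ∑ᶠ c ∈ (D₀ : Set (Fin (p ^ (k - 1)) → ZMod p)),
          (X + (p - 1) * Y) ^ (p ^ (k - 1) - hammingNorm c) * (X - Y) ^ (hammingNorm c)
      = X ^ (p ^ (k - 1)) + (p - 1) * Y ^ (p ^ (k - 1))
        + ((p : ℂ) ^ k - p) * X ^ (p ^ (k - 2)) * Y ^ ((p - 1) * p ^ (k - 2)) := by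
  have : Fact p.Prime := ⟨hp⟩
  obtain ⟨m, rfl⟩ : ∃ m, k = m + 2 := ⟨k - 2, by omega⟩
  subst hP hD
  change Fin (m + 2) → Fin (p ^ (m + 1)) → ZMod p at A
  have key : ∀ X Y : ℂ, (p : ℂ) ^ (m + 2) *
      ∑ᶠ c ∈ (dualCode (Submodule.span (ZMod p) (Set.range A)) :
          Set (Fin (p ^ (m + 1)) → ZMod p)),
        (X + (p - 1) * Y) ^ (p ^ (m + 1) - hammingNorm c) * (X - Y) ^ (hammingNorm c)
      = (p : ℂ) ^ (p ^ (m + 1)) * (X ^ (p ^ (m + 1)) + (p - 1) * Y ^ (p ^ (m + 1))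
        + ((p : ℂ) ^ (m + 2) - p) * X ^ (p ^ m) * Y ^ ((p - 1) * p ^ m)) := by
    intro X Y
    rw [← sum_code A hrow0 hB, ← macw, finsum_code]
    simp_rw [prod_wfac]
  have hp0 : (p : ℂ) ≠ 0 := by exact_mod_cast hp.ne_zero
  have hcard : (p : ℂ) ^ (m + 2) *
      (Nat.card (dualCode (Submodule.span (ZMod p) (Set.range A))) : ℂ)
      = (p : ℂ) ^ (p ^ (m + 1)) := by
    have h := key 1 0
    have e1 : p ^ (m + 1) ≠ 0 := pow_ne_zero _ hp.ne_zero
    have e2 : (p - 1) * p ^ m ≠ 0 :=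
      mul_ne_zero (by have := hp.two_le; omega) (pow_ne_zero _ hp.ne_zero)
    rw [zero_pow e1, zero_pow e2] at h
    simp only [mul_zero, add_zero, sub_zero, one_pow, mul_one] at h
    rw [← h]
    congr 1
    rw [finsum_mem_eq_finite_toFinset_sum _ (Set.toFinite _)]
    rw [Finset.sum_const, nsmul_eq_mul, mul_one, ← Set.ncard_eq_toFinset_card]
    rfl
  have hk2 := key X Y
  rw [← hcard] at hk2
  have hpk : (p : ℂ) ^ (m + 2) ≠ 0 := pow_ne_zero _ hp0
  have hc0 : (Nat.card (dualCode (Submodule.span (ZMod p) (Set.range A))) : ℂ) ≠ 0 := by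
    intro h
    rw [h, mul_zero] at hcard
    exact pow_ne_zero _ hp0 hcard.symm
  rw [mul_assoc] at hk2
  have hk3 := mul_left_cancel₀ hpk hk2
  rw [one_div]
  exact (inv_mul_eq_iff_eq_mul₀ hc0).mpr hk3
end

section
/- With D and P as above, let H ⊆ Z_p^{p^{k-1}} be the repetition code generated by the all-ones vector, and let D_i be a coset of D contained in H^⊥ with D_i ≠ D. Then (1/|D_i|)·W_{D_i}(X + (p−1)Y, X − Y) = X^{p^{k-1}} + (p−1)Y^{p^{k-1}} − p·X^{p^{k-2}}·Y^{(p-1)p^{k-2}}. -/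
theorem s7_map (p : ℕ) [Fact p.Prime] {ι : Type*} (s : Finset ι) (f : ι → ZMod p) :
    (ZMod.stdAddChar (∑ i ∈ s, f i) : ℂ) = ∏ i ∈ s, ZMod.stdAddChar (f i) := by
  classical
  induction s using Finset.induction_on with
  | empty => simp
  | insert a s ha ih => rw [Finset.sum_insert ha, Finset.prod_insert ha, AddChar.map_add_eq_mul, ih]

open Finset in
theorem s7_orth (p : ℕ) [Fact p.Prime] {ι : Type*} [Fintype ι] [DecidableEq ι] (s : ι → ZMod p) :
    ∑ m : ι → ZMod p, ZMod.stdAddChar (∑ i, m i * s i) =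
      if (∀ i, s i = 0) then (p : ℂ) ^ Fintype.card ι else 0 := by
  have h1 : ∀ m : ι → ZMod p, (ZMod.stdAddChar (∑ i, m i * s i) : ℂ) =
      ∏ i, ZMod.stdAddChar (m i * s i) := by
    intro m
    exact s7_map p _ _
  simp_rw [h1]
  rw [← Fintype.prod_sum (fun i (a : ZMod p) => (ZMod.stdAddChar (a * s i) : ℂ))]
  have h2 : ∀ i, ∑ a : ZMod p, (ZMod.stdAddChar (a * s i) : ℂ) = if s i = 0 then (p : ℂ) else 0 := by
    intro i
    rw [AddChar.sum_mulShift _ (ZMod.isPrimitive_stdAddChar p)]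
    simp [ZMod.card]
  simp_rw [h2]
  split_ifs with h
  · simp [h]
  · push Not at h
    obtain ⟨i, hi⟩ := h
    exact Finset.prod_eq_zero (mem_univ i) (by simp [hi])

open Finset in
theorem s7_pow (p : ℕ) {J : Type*} [Fintype J] [DecidableEq J] (u : J → ZMod p) (a b : ℂ) :
    ∏ j, (if u j = 0 then a else b) = a ^ (Fintype.card J - hammingNorm u) * b ^ hammingNorm u := by
  rw [Finset.prod_ite]
  simp only [Finset.prod_const]
  have h : #{j | u j = 0} + #{j | ¬ u j = 0} = Fintype.card J := by
    rw [Finset.card_filter_add_card_filter_not]; rfl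
  have h2 : hammingNorm u = #{j | ¬ u j = 0} := rfl
  rw [h2, ← h, Nat.add_sub_cancel]

open Finset in
theorem s7_four (p : ℕ) [Fact p.Prime] (X Y : ℂ) (b : ZMod p) :
    ∑ a : ZMod p, (if a = 0 then X + (p - 1) * Y else X - Y) * ZMod.stdAddChar (a * b) =
      p * (if b = 0 then X else Y) := by
  have h : ∀ a : ZMod p, (if a = 0 then X + (p - 1) * Y else X - Y) * (ZMod.stdAddChar (a * b) : ℂ)
     = (X - Y) * ZMod.stdAddChar (a * b) + if a = 0 then p * Y else 0 := by
    intro a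
    split_ifs with h
    · simp [h]; ring
    · simp
  simp_rw [h]
  rw [sum_add_distrib, ← mul_sum, AddChar.sum_mulShift _ (ZMod.isPrimitive_stdAddChar p)]
  simp [ZMod.card]
  split_ifs <;> ring

open Finset in
theorem s7_mac (p : ℕ) [Fact p.Prime] {ι J : Type*} [Fintype ι] [DecidableEq ι] [Fintype J]
    [DecidableEq J] (A : ι → J → ZMod p) (v : J → ZMod p) (X Y : ℂ) :
    (p : ℂ) ^ Fintype.card ι * ∑ u : J → ZMod p, (if ∀ i, ∑ j, (u j - v j) * A i j = 0 then
      (X + (p - 1) * Y) ^ (Fintype.card J - hammingNorm u) * (X - Y) ^ hammingNorm u else 0)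
    = p ^ Fintype.card J * ∑ m : ι → ZMod p,
      ZMod.stdAddChar (- ∑ i, m i * ∑ j, v j * A i j) *
        ∏ j, (if ∑ i, m i * A i j = 0 then X else Y) := by
  have h1 : ∀ m : ι → ZMod p, (p : ℂ) ^ Fintype.card J * ∏ j, (if ∑ i, m i * A i j = 0 then X else Y)
      = ∑ u : J → ZMod p, ((X + (p - 1) * Y) ^ (Fintype.card J - hammingNorm u) *
        (X - Y) ^ hammingNorm u) * ZMod.stdAddChar (∑ j, u j * ∑ i, m i * A i j) := by
    intro m
    rw [← card_univ, ← prod_const, ← prod_mul_distrib]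
    simp_rw [← s7_four]
    rw [Fintype.prod_sum]
    refine sum_congr rfl fun u _ => ?_
    rw [prod_mul_distrib, s7_pow, card_univ]
    congr 1
    exact (s7_map p _ _).symm
  rw [mul_sum, mul_sum]
  have h2 : ∀ m : ι → ZMod p, (p : ℂ) ^ Fintype.card J * (ZMod.stdAddChar (- ∑ i, m i * ∑ j, v j * A i j) *
        ∏ j, (if ∑ i, m i * A i j = 0 then X else Y)) = ∑ u : J → ZMod p,
        ((X + (p - 1) * Y) ^ (Fintype.card J - hammingNorm u) *
        (X - Y) ^ hammingNorm u) * ZMod.stdAddChar (∑ i, m i * ∑ j, (u j - v j) * A i j) := by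
    intro m
    rw [mul_left_comm, h1, mul_sum]
    refine sum_congr rfl fun u _ => ?_
    rw [mul_left_comm, ← AddChar.map_add_eq_mul]
    congr 2
    simp_rw [sub_mul, sum_sub_distrib, mul_sub, sum_sub_distrib]
    rw [neg_add_eq_sub]
    congr 1
    simp_rw [mul_sum]
    rw [sum_comm]
    refine sum_congr rfl fun i _ => sum_congr rfl fun j _ => by ring
  simp_rw [h2]
  rw [sum_comm]
  refine sum_congr rfl fun u _ => ?_
  rw [← mul_sum, s7_orth]
  split_ifs <;> ring

open Finset in
theorem s7_count (p r : ℕ) [Fact p.Prime] (s : Fin (r + 1) → ZMod p) (hs : ¬ ∀ i, s i = 0)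
    (a : ZMod p) : #{x : Fin (r + 1) → ZMod p | a + ∑ i, s i * x i = 0} = p ^ r := by
  have hp0 : (p : ℂ) ≠ 0 := by exact_mod_cast (Fact.out : p.Prime).ne_zero
  have h : (p : ℂ) * #{x : Fin (r + 1) → ZMod p | a + ∑ i, s i * x i = 0} = p * p ^ r := by
    rw [card_filter]
    push_cast
    rw [mul_sum]
    have h1 : ∀ x : Fin (r + 1) → ZMod p, (p : ℂ) * (if a + ∑ i, s i * x i = 0 then 1 else 0) =
      ∑ t : ZMod p, ZMod.stdAddChar (t * a) * ZMod.stdAddChar (∑ i, x i * (t * s i)) := by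
      intro x
      have : ∀ t : ZMod p, (ZMod.stdAddChar (t * a) : ℂ) * ZMod.stdAddChar (∑ i, x i * (t * s i)) =
        ZMod.stdAddChar (t * (a + ∑ i, s i * x i)) := by
        intro t
        rw [← AddChar.map_add_eq_mul, mul_add, mul_sum]
        congr 2
        exact sum_congr rfl fun i _ => by ring
      simp_rw [this]
      rw [AddChar.sum_mulShift _ (ZMod.isPrimitive_stdAddChar p)]
      simp [ZMod.card]
    simp_rw [h1]
    rw [sum_comm]
    simp_rw [← mul_sum, s7_orth]
    rw [sum_eq_single 0]
    · simp [pow_succ']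
    · intro t _ ht
      rw [if_neg, mul_zero]
      simpa [ht] using hs
    · simp
  exact_mod_cast mul_left_cancel₀ hp0 h

open Finset in
theorem s7_main (p r : ℕ) [Fact p.Prime] {J : Type*} [Fintype J]
    [DecidableEq J] (hJ : Fintype.card J = p ^ (r + 1)) (A : Fin (r + 2) → J → ZMod p)
    (h0 : ∀ j, A 0 j = 1)
    (hB : Function.Bijective (fun (j : J) => fun (i : Fin (r + 1)) => A i.succ j))
    (w : Fin (r + 2) → ZMod p) (hw0 : w 0 = 0) (X Y : ℂ) :
    ∑ m : Fin (r + 2) → ZMod p, ZMod.stdAddChar (- ∑ i, m i * w i) *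
        ∏ j, (if ∑ i, m i * A i j = 0 then X else Y)
    = X ^ (p ^ (r + 1)) + (p - 1) * Y ^ (p ^ (r + 1)) +
      ((if ∀ i, w i = 0 then (p : ℂ) ^ (r + 2) else 0) - p) * (X ^ (p ^ r) * Y ^ ((p - 1) * p ^ r)) := by
  set E := X ^ (p ^ r) * Y ^ ((p - 1) * p ^ r) with hE
  have hpp : p ^ (r + 1) = p ^ r + (p - 1) * p ^ r := by
    obtain ⟨q, rfl⟩ : ∃ q, p = q + 1 := ⟨p - 1, by have := (Fact.out : p.Prime).pos; omega⟩
    rw [Nat.add_sub_cancel]; ring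
  have hprod : ∀ m : Fin (r + 2) → ZMod p, ∏ j, (if ∑ i, m i * A i j = 0 then X else Y) =
      E + if ∀ i : Fin (r + 1), m i.succ = 0 then
        (if m 0 = 0 then X ^ (p ^ (r + 1)) else Y ^ (p ^ (r + 1))) - E else 0 := by
    intro m
    have hs : ∀ j, ∑ i, m i * A i j = m 0 + ∑ i : Fin (r + 1), m i.succ * A i.succ j := by
      intro j; rw [Fin.sum_univ_succ, h0, mul_one]
    simp_rw [hs]
    split_ifs with h1 h2
    · simp [h1, h2, hJ]
    · simp [h1, h2, hJ]
    · rw [prod_ite, prod_const, prod_const, add_zero, hE]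
      have hc : #{j : J | m 0 + ∑ i : Fin (r + 1), m i.succ * A i.succ j = 0} = p ^ r := by
        rw [← s7_count p r (fun i => m i.succ) h1 (m 0)]
        refine card_bij (fun j _ => fun i => A i.succ j) ?_ ?_ ?_
        · intro j hj; simpa using hj
        · intro a _ b _ h; exact hB.1 h
        · intro x hx
          obtain ⟨j, hj⟩ := hB.2 x
          refine ⟨j, ?_, hj⟩
          subst hj
          simpa using hx
      have hc2 : #{j : J | ¬ (m 0 + ∑ i : Fin (r + 1), m i.succ * A i.succ j = 0)} =
          (p - 1) * p ^ r := by
        have := card_filter_add_card_filter_not (s := (univ : Finset J))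
          (fun j => m 0 + ∑ i : Fin (r + 1), m i.succ * A i.succ j = 0)
        rw [card_univ, hJ, hc] at this
        omega
      rw [hc, hc2]
  simp_rw [hprod, mul_add, sum_add_distrib, ← sum_mul]
  have h1 : ∑ m : Fin (r + 2) → ZMod p, (ZMod.stdAddChar (- ∑ i, m i * w i) : ℂ) =
     if ∀ i, w i = 0 then (p : ℂ) ^ (r + 2) else 0 := by
    have := s7_orth p (fun i => - w i)
    simpa using this
  rw [h1]
  have h2 : ∑ m : Fin (r + 2) → ZMod p, (ZMod.stdAddChar (- ∑ i, m i * w i) : ℂ) *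
      (if ∀ i : Fin (r + 1), m i.succ = 0 then
        (if m 0 = 0 then X ^ (p ^ (r + 1)) else Y ^ (p ^ (r + 1))) - E else 0) =
      ∑ a : ZMod p, ((if a = 0 then X ^ (p ^ (r + 1)) else Y ^ (p ^ (r + 1))) - E) := by
    rw [← (Fin.consEquiv (fun _ : Fin (r + 2) => ZMod p)).sum_comp, Fintype.sum_prod_type]
    refine sum_congr rfl fun a _ => ?_
    rw [sum_eq_single 0]
    · simp [Fin.sum_univ_succ, hw0, Fin.consEquiv]
    · intro b _ hb
      rw [if_neg, mul_zero]
      intro h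
      apply hb
      funext i
      simpa [Fin.consEquiv] using h i
    · simp
  have h3 : ∑ a : ZMod p, (if a = 0 then X ^ (p ^ (r + 1)) else Y ^ (p ^ (r + 1))) =
      X ^ (p ^ (r + 1)) + (p - 1) * Y ^ (p ^ (r + 1)) := by
    have : ∀ a : ZMod p, (if a = 0 then X ^ (p ^ (r + 1)) else Y ^ (p ^ (r + 1))) =
      Y ^ (p ^ (r + 1)) + if a = 0 then X ^ (p ^ (r + 1)) - Y ^ (p ^ (r + 1)) else 0 := by
      intro a; split_ifs <;> ring
    simp_rw [this, sum_add_distrib]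
    simp [ZMod.card]
    ring
  rw [h2, sum_sub_distrib, h3]
  simp only [sum_const, card_univ, ZMod.card, nsmul_eq_mul]
  ring

theorem s7_mem (p : ℕ) {k n : ℕ} (A : Fin k → Fin n → ZMod p) (x : Fin n → ZMod p) :
    x ∈ dualCode (Submodule.span (ZMod p) (Set.range A)) ↔ ∀ i, ∑ j, x j * A i j = 0 := by
  constructor
  · intro h i
    exact h _ (Submodule.subset_span ⟨i, rfl⟩)
  · intro h c hc
    induction hc using Submodule.span_induction with
    | mem c hc => obtain ⟨i, rfl⟩ := hc; exact h i
    | zero => simp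
    | add a b _ _ ha hb => simp [mul_add, Finset.sum_add_distrib, ha, hb]
    | smul t a _ ha => 
      simp only [Pi.smul_apply, smul_eq_mul, mul_left_comm _ t, ← Finset.mul_sum, ha, mul_zero]

/-- for a nontrivial coset `Dᵢ = v + D` of `D = P^⊥` contained in the sum-zero code
`H^⊥`, the MacWilliams-transformed weight enumerator satisfies
`(1/|Dᵢ|)·W_{Dᵢ}(X+(p-1)Y, X-Y) = X^{p^{k-1}} + (p-1)Y^{p^{k-1}} - p·X^{p^{k-2}}Y^{(p-1)p^{k-2}}`. -/
theorem stmt7 (p k : ℕ) (hp : p.Prime) (hk : 2 ≤ k)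
    (A : Fin k → Fin (p ^ (k - 1)) → ZMod p)
    (hrow0 : ∀ j, A ⟨0, by omega⟩ j = 1)
    (hB : Function.Bijective
      (fun (j : Fin (p ^ (k - 1))) => fun (i : Fin (k - 1)) => A ⟨i.val + 1, by omega⟩ j))
    (P : Submodule (ZMod p) (Fin (p ^ (k - 1)) → ZMod p))
    (hP : P = Submodule.span (ZMod p) (Set.range A))
    (D : Submodule (ZMod p) (Fin (p ^ (k - 1)) → ZMod p))
    (hD : D = dualCode P)
    (v : Fin (p ^ (k - 1)) → ZMod p)
    (hv0 : ∑ j, v j = 0)   -- the coset `v + D` is contained in `H^⊥`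
    (hv1 : v ∉ D)          -- the coset is different from `D` itself
    (X Y : ℂ) :
    (1 / (Nat.card D : ℂ)) *
        ∑ᶠ c ∈ {u : Fin (p ^ (k - 1)) → ZMod p | ∃ d ∈ D, u = v + d},
          (X + (p - 1) * Y) ^ (p ^ (k - 1) - hammingNorm c) * (X - Y) ^ (hammingNorm c)
      = X ^ (p ^ (k - 1)) + (p - 1) * Y ^ (p ^ (k - 1))
        - p * X ^ (p ^ (k - 2)) * Y ^ ((p - 1) * p ^ (k - 2)) := by
  classical
  have : Fact p.Prime := ⟨hp⟩
  obtain ⟨r, rfl⟩ : ∃ r, k = r + 2 := ⟨k - 2, by omega⟩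
  subst hP
  have hmem : ∀ x, x ∈ D ↔ ∀ i, ∑ j, x j * A i j = 0 := by
    intro x; rw [hD]; exact s7_mem p A x
  have hJ : Fintype.card (Fin (p ^ (r + 2 - 1))) = p ^ (r + 1) := by simp
  have hp0 : (p : ℂ) ≠ 0 := by exact_mod_cast hp.ne_zero
  have hcard : (p : ℂ) ^ (r + 2) * (Nat.card D : ℂ) = p ^ (p ^ (r + 1)) := by
    have h1 := s7_mac p A 0 1 0
    have h2 := s7_main p r hJ A hrow0 hB 0 rfl 1 0
    simp only [Pi.zero_apply, zero_mul, Finset.sum_const_zero, mul_zero] at h1 h2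
    rw [h2, hJ] at h1
    have hq : (p - 1) * p ^ r ≠ 0 :=
      Nat.mul_ne_zero (by have := hp.two_le; omega) (pow_ne_zero _ hp.ne_zero)
    have hq2 : p ^ (r + 1) ≠ 0 := pow_ne_zero _ hp.ne_zero
    simp [hq, hq2, hp.ne_zero] at h1
    rw [← h1]
    congr 2
    rw [Nat.card_eq_fintype_card, Fintype.card_subtype]
    congr 1
    ext x
    simp [hmem]
  have hsum : (p : ℂ) ^ (r + 2) * ∑ᶠ c ∈ {u : Fin (p ^ (r + 2 - 1)) → ZMod p | ∃ d ∈ D, u = v + d},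
          (X + (p - 1) * Y) ^ (p ^ (r + 2 - 1) - hammingNorm c) * (X - Y) ^ (hammingNorm c) =
      p ^ (p ^ (r + 1)) * (X ^ (p ^ (r + 1)) + (p - 1) * Y ^ (p ^ (r + 1))
        - p * X ^ (p ^ r) * Y ^ ((p - 1) * p ^ r)) := by
    have h1 := s7_mac p A v X Y
    have hw0 : (fun i => ∑ j, v j * A i j) 0 = 0 := by
      have : ∀ j, A 0 j = 1 := hrow0
      simp [this, hv0]
    have h2 := s7_main p r hJ A hrow0 hB (fun i => ∑ j, v j * A i j) hw0 X Y
    have hne : ¬ ∀ i, ∑ j, v j * A i j = 0 := fun h => hv1 ((hmem v).2 h)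
    rw [h2, hJ] at h1
    simp only [if_neg hne, Fintype.card_fin] at h1
    rw [finsum_mem_def, finsum_eq_sum_of_fintype]
    have e : (X ^ (p ^ (r + 1)) + (p - 1) * Y ^ (p ^ (r + 1))
        - p * X ^ (p ^ r) * Y ^ ((p - 1) * p ^ r)) = X ^ p ^ (r + 1) + (↑p - 1) * Y ^ p ^ (r + 1) + (0 - ↑p) * (X ^ p ^ r * Y ^ ((p - 1) * p ^ r)) := by ring
    rw [e, ← h1]
    congr 1
    refine Finset.sum_congr rfl fun u _ => ?_
    rw [Set.indicator_apply]
    refine (if_congr (Q := ∀ i, ∑ j, (u j - v j) * A i j = 0) ?_ rfl rfl).trans (by congr)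
    have h3 := hmem (u - v)
    simp only [Pi.sub_apply] at h3
    rw [← h3]
    constructor
    · rintro ⟨d, hd, rfl⟩
      simpa using hd
    · intro h
      exact ⟨u - v, h, by simp⟩
  have hpk : (p : ℂ) ^ (r + 2) ≠ 0 := pow_ne_zero _ hp0
  have hD0 : (Nat.card D : ℂ) ≠ 0 := by
    intro h
    rw [h, mul_zero] at hcard
    exact pow_ne_zero _ hp0 hcard.symm
  rw [one_div, inv_mul_eq_iff_eq_mul₀ hD0]
  apply mul_left_cancel₀ hpk
  rw [hsum, ← mul_assoc, hcard]
  rfl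
end

section
/- With D and P as above, let D_i be a coset of D not contained in the sum-zero code H^⊥ (i.e., the coordinate sum of its elements is nonzero mod p). Then (1/|D_i|)·W_{D_i}(X + (p−1)Y, X − Y) = X^{p^{k-1}} − Y^{p^{k-1}}. -/
lemma aux_sum {R ι : Type*} [CommRing R] (ψ : AddChar R ℂ) (s : Finset ι) (f : ι → R) :
    ψ (∑ i ∈ s, f i) = ∏ i ∈ s, ψ (f i) := by
  classical
  induction s using Finset.induction_on with
  | empty => simp
  | insert a s ha ih => rw [Finset.sum_insert ha, Finset.prod_insert ha,
      AddChar.map_add_eq_mul, ih]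

lemma aux_ind {p : ℕ} [Fact p.Prime] {κ : Type*} [Fintype κ] [DecidableEq κ]
    (ψ : AddChar (ZMod p) ℂ) (hψ : ψ.IsPrimitive) (w : κ → ZMod p) :
    ∑ t : κ → ZMod p, ψ (∑ i, t i * w i) = if w = 0 then (p : ℂ) ^ Fintype.card κ else 0 := by
  have h1 : ∀ t : κ → ZMod p, ψ (∑ i, t i * w i) = ∏ i, ψ (t i * w i) := by
    intro t
    exact aux_sum ψ _ _
  simp_rw [h1]
  rw [← Fintype.piFinset_univ, ← Finset.prod_univ_sum (fun _ => Finset.univ)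
    (fun i x => ψ (x * w i))]
  simp_rw [AddChar.sum_mulShift _ hψ, ZMod.card]
  split_ifs with h
  · subst h
    simp
  · obtain ⟨i, hi⟩ := Function.ne_iff.mp h
    refine Finset.prod_eq_zero (Finset.mem_univ i) ?_
    simp only [Pi.zero_apply] at hi
    simp [hi]

lemma aux_g {p : ℕ} [Fact p.Prime] (ψ : AddChar (ZMod p) ℂ) (hψ : ψ.IsPrimitive) (X Y : ℂ)
    (u : ZMod p) :
    ∑ x : ZMod p, ψ (x * u) * (if x = 0 then X + (p - 1) * Y else X - Y)
      = p * (if u = 0 then X else Y) := by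
  have h : ∀ x : ZMod p, ψ (x * u) * (if x = 0 then X + (p - 1) * Y else X - Y)
      = ψ (x * u) * (X - Y) + if x = 0 then p * Y else 0 := by
    intro x
    split_ifs with hx
    · subst hx
      simp
      ring
    · simp
  simp_rw [h, Finset.sum_add_distrib, ← Finset.sum_mul]
  rw [AddChar.sum_mulShift _ hψ, ZMod.card]
  split_ifs <;> simp
  ring

lemma aux_f {p : ℕ} [Fact p.Prime] {ι : Type*} [Fintype ι] [DecidableEq ι]
    (c : ι → ZMod p) (a b : ℂ) :
    a ^ (Fintype.card ι - hammingNorm c) * b ^ hammingNorm c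
      = ∏ j, if c j = 0 then a else b := by
  classical
  rw [Finset.prod_ite]
  simp only [Finset.prod_const]
  unfold hammingNorm
  have := Finset.card_filter_add_card_filter_not (s := (Finset.univ : Finset ι))
    (fun j => c j = 0)
  rw [Finset.card_univ] at this
  congr 2
  simp only [ne_eq]
  omega

lemma aux_t {p m : ℕ} [Fact p.Prime] {ι : Type*} [Fintype ι] [DecidableEq ι]
    (ψ : AddChar (ZMod p) ℂ) (hψ : ψ.IsPrimitive)
    (A : Fin (m + 1) → ι → ZMod p) (h0 : ∀ j, A 0 j = 1)
    (hB : Function.Bijective (fun (j : ι) => fun (i : Fin m) => A i.succ j))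
    (s : Fin (m + 1) → ZMod p) (hs : s 0 ≠ 0) (X Y : ℂ) :
    ∑ t : Fin (m + 1) → ZMod p, ψ (-∑ i, t i * s i) *
      ∏ j, (if ∑ i, t i * A i j = 0 then X else Y)
      = X ^ Fintype.card ι - Y ^ Fintype.card ι := by
  rw [← (Fin.consEquiv (fun _ => ZMod p)).sum_comp, Fintype.sum_prod_type_right]
  simp only [Fin.consEquiv_apply, Fin.sum_univ_succ, Fin.cons_zero, Fin.cons_succ, h0, mul_one]
  have hsum : ∑ a : ZMod p, ψ (-(a * s 0)) = 0 := by
    have := AddChar.sum_mulShift (-s 0) hψ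
    simpa [hs] using this
  rw [Finset.sum_eq_single (0 : Fin m → ZMod p)]
  · simp only [Pi.zero_apply, zero_mul, Finset.sum_const_zero, add_zero, Finset.prod_const,
      Finset.card_univ]
    have h : ∀ x : ZMod p, ψ (-(x * s 0)) * (if x = 0 then X else Y) ^ Fintype.card ι
      = ψ (-(x * s 0)) * Y ^ Fintype.card ι
        + if x = 0 then X ^ Fintype.card ι - Y ^ Fintype.card ι else 0 := by
      intro x
      split_ifs with hx
      · subst hx
        simp
      · simp
    simp_rw [h, Finset.sum_add_distrib, ← Finset.sum_mul, hsum]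
    simp
  · intro b _ hb
    obtain ⟨i, hi⟩ := Function.ne_iff.mp hb
    simp only [Pi.zero_apply] at hi
    have key : ∀ a : ZMod p, ∏ j, (if a + ∑ i, b i * A i.succ j = 0 then X else Y)
        = ∏ x : Fin m → ZMod p, (if ∑ i, b i * x i = 0 then X else Y) := by
      intro a
      rw [← Equiv.prod_comp (Equiv.addRight (Pi.single i (a / b i) : Fin m → ZMod p))]
      rw [← (Equiv.ofBijective _ hB).prod_comp]
      refine Finset.prod_congr rfl fun j _ => ?_
      have : ∑ l, b l * (Equiv.addRight (Pi.single i (a / b i) : Fin m → ZMod p)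
          ((Equiv.ofBijective _ hB) j)) l = a + ∑ i, b i * A i.succ j := by
        simp only [Equiv.coe_addRight, Equiv.ofBijective_apply, Pi.add_apply, mul_add,
          Finset.sum_add_distrib]
        rw [add_comm]
        congr 1
        rw [Finset.sum_eq_single i]
        · simp [mul_div_cancel₀, hi]
        · intro l _ hl
          simp [Pi.single_eq_of_ne hl]
        · simp
      rw [this]
    simp_rw [key, neg_add, AddChar.map_add_eq_mul]
    rw [← Finset.sum_mul, ← Finset.sum_mul, hsum]
    simp
  · simp

lemma aux_main {p m : ℕ} [Fact p.Prime] {ι : Type*} [Fintype ι] [DecidableEq ι]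
    (A : Fin (m + 1) → ι → ZMod p) (h0 : ∀ j, A 0 j = 1)
    (hB : Function.Bijective (fun (j : ι) => fun (i : Fin m) => A i.succ j))
    (v : ι → ZMod p) (hv : ∑ j, v j ≠ 0) (X Y : ℂ) :
    (p : ℂ) ^ (m + 1) * ∑ c : ι → ZMod p,
      (if (∀ i, ∑ j, (c j - v j) * A i j = 0) then
        (X + (p - 1) * Y) ^ (Fintype.card ι - hammingNorm c) * (X - Y) ^ hammingNorm c else 0)
    = (p : ℂ) ^ Fintype.card ι * (X ^ Fintype.card ι - Y ^ Fintype.card ι) := by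
  have hψ := ZMod.isPrimitive_stdAddChar p
  set ψ : AddChar (ZMod p) ℂ := ZMod.stdAddChar
  rw [← aux_t ψ hψ A h0 hB (fun i => ∑ j, v j * A i j) (by simpa [h0] using hv) X Y,
    Finset.mul_sum, Finset.mul_sum]
  have h1 : ∀ c : ι → ZMod p, (p : ℂ) ^ (m + 1) *
      (if (∀ i, ∑ j, (c j - v j) * A i j = 0) then
        (X + (p - 1) * Y) ^ (Fintype.card ι - hammingNorm c) * (X - Y) ^ hammingNorm c else 0)
      = ∑ t : Fin (m + 1) → ZMod p, ψ (∑ i, t i * ∑ j, (c j - v j) * A i j) *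
        ∏ j, if c j = 0 then X + (p - 1) * Y else X - Y := by
    intro c
    rw [← Finset.sum_mul, aux_ind ψ hψ (fun i => ∑ j, (c j - v j) * A i j), aux_f]
    simp only [funext_iff, Pi.zero_apply, Fintype.card_fin]
    split_ifs <;> simp
  simp_rw [h1]
  rw [Finset.sum_comm]
  refine Finset.sum_congr rfl fun t _ => ?_
  have h2 : ∀ c : ι → ZMod p, ψ (∑ i, t i * ∑ j, (c j - v j) * A i j) *
        (∏ j, if c j = 0 then X + (p - 1) * Y else X - Y)
      = ψ (-∑ i, t i * ∑ j, v j * A i j) *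
        ∏ j, (ψ (c j * ∑ i, t i * A i j) * if c j = 0 then X + (p - 1) * Y else X - Y) := by
    intro c
    rw [Finset.prod_mul_distrib, ← aux_sum, ← mul_assoc,
      ← AddChar.map_add_eq_mul]
    congr 2
    simp only [sub_mul, Finset.sum_sub_distrib, mul_sub]
    rw [neg_add_eq_sub]
    congr 1
    simp only [Finset.mul_sum]
    rw [Finset.sum_comm]
    refine Finset.sum_congr rfl fun _ _ => Finset.sum_congr rfl fun _ _ => by ring
  simp_rw [h2]
  rw [← Finset.mul_sum, ← Fintype.piFinset_univ, ← Finset.prod_univ_sum (fun _ => Finset.univ)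
    (fun j x => ψ (x * ∑ i, t i * A i j) * if x = 0 then X + (p - 1) * Y else X - Y)]
  simp_rw [aux_g ψ hψ X Y, Finset.prod_mul_distrib]
  simp only [Finset.prod_const, Finset.card_univ]
  ring

lemma aux_dual {p k n : ℕ} (A : Fin k → Fin n → ZMod p) (x : Fin n → ZMod p) :
    x ∈ dualCode (Submodule.span (ZMod p) (Set.range A)) ↔ ∀ i, ∑ j, x j * A i j = 0 := by
  constructor
  · intro h i
    exact h _ (Submodule.subset_span ⟨i, rfl⟩)
  · intro h c hc
    induction hc using Submodule.span_induction with
    | mem y hy => obtain ⟨i, rfl⟩ := hy; exact h i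
    | zero => simp
    | add y z _ _ hy hz => simp [mul_add, Finset.sum_add_distrib, hy, hz]
    | smul r y _ hy =>
      simp only [Pi.smul_apply, smul_eq_mul, mul_left_comm, ← Finset.mul_sum, hy, mul_zero]

/-- for a coset `Dᵢ = v + D` of `D = P^⊥` not contained in the sum-zero code `H^⊥`,
`(1/|Dᵢ|)·W_{Dᵢ}(X+(p-1)Y, X-Y) = X^{p^{k-1}} - Y^{p^{k-1}}`. -/
theorem stmt8 (p k : ℕ) (hp : p.Prime) (hk : 2 ≤ k)
    (A : Fin k → Fin (p ^ (k - 1)) → ZMod p)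
    (hrow0 : ∀ j, A ⟨0, by omega⟩ j = 1)
    (hB : Function.Bijective
      (fun (j : Fin (p ^ (k - 1))) => fun (i : Fin (k - 1)) => A ⟨i.val + 1, by omega⟩ j))
    (P : Submodule (ZMod p) (Fin (p ^ (k - 1)) → ZMod p))
    (hP : P = Submodule.span (ZMod p) (Set.range A))
    (D : Submodule (ZMod p) (Fin (p ^ (k - 1)) → ZMod p))
    (hD : D = dualCode P)
    (v : Fin (p ^ (k - 1)) → ZMod p)
    (hv0 : ∑ j, v j ≠ 0)   -- the coset `v + D` lies outside `H^⊥`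
    (X Y : ℂ) :
    (1 / (Nat.card D : ℂ)) *
        ∑ᶠ c ∈ {u : Fin (p ^ (k - 1)) → ZMod p | ∃ d ∈ D, u = v + d},
          (X + (p - 1) * Y) ^ (p ^ (k - 1) - hammingNorm c) * (X - Y) ^ (hammingNorm c)
      = X ^ (p ^ (k - 1)) - Y ^ (p ^ (k - 1)) := by
  have : Fact p.Prime := ⟨hp⟩
  obtain ⟨m, rfl⟩ : ∃ m, k = m + 1 := ⟨k - 1, by omega⟩
  subst hP
  classical
  have hmem : ∀ x, x ∈ D ↔ ∀ i, ∑ j, x j * A i j = 0 := by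
    intro x
    rw [hD]
    exact aux_dual A x
  have hS : ∀ X Y : ℂ, (p : ℂ) ^ (m + 1) *
      ∑ᶠ c ∈ {u : Fin (p ^ (m + 1 - 1)) → ZMod p | ∃ d ∈ D, u = v + d},
          (X + (p - 1) * Y) ^ (p ^ (m + 1 - 1) - hammingNorm c) * (X - Y) ^ (hammingNorm c)
      = (p : ℂ) ^ (p ^ (m + 1 - 1)) * (X ^ (p ^ (m + 1 - 1)) - Y ^ (p ^ (m + 1 - 1))) := by
    intro X Y
    have h := aux_main (m := m) A hrow0 hB v hv0 X Y
    rw [Fintype.card_fin] at h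
    rw [← h, finsum_mem_eq_finite_toFinset_sum _ (Set.toFinite _), ← Finset.sum_filter]
    congr 1
    refine Finset.sum_congr ?_ fun _ _ => rfl
    ext c
    simp only [Set.Finite.mem_toFinset, Set.mem_ofPred_eq, Finset.mem_filter, Finset.mem_univ,
      true_and]
    have h3 : (∃ d ∈ D, c = v + d) ↔ c - v ∈ D := by
      constructor
      · rintro ⟨d, hd, rfl⟩
        simpa using hd
      · intro h
        exact ⟨c - v, h, by simp⟩
    rw [h3, hmem]
    rfl
  have hp0 : (p : ℂ) ≠ 0 := by exact_mod_cast hp.ne_zero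
  have hn0 : p ^ (m + 1 - 1) ≠ 0 := pow_ne_zero _ hp.ne_zero
  have hcard : (p : ℂ) ^ (m + 1) * (Nat.card D : ℂ) = (p : ℂ) ^ (p ^ (m + 1 - 1)) := by
    have h := hS 1 0
    simp only [mul_zero, add_zero, sub_zero, one_pow, mul_one, zero_pow hn0] at h
    rw [← h]
    congr 1
    have himg : {u : Fin (p ^ (m + 1 - 1)) → ZMod p | ∃ d ∈ D, u = v + d}
        = (fun d => v + d) '' (D : Set _) := by
      ext u
      constructor
      · rintro ⟨d, hd, rfl⟩
        exact ⟨d, hd, rfl⟩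
      · rintro ⟨d, hd, rfl⟩
        exact ⟨d, hd, rfl⟩
    rw [himg, finsum_mem_image (fun a _ b _ hab => add_left_cancel hab),
      finsum_mem_eq_finite_toFinset_sum _ (Set.toFinite _)]
    simp only [Finset.sum_const, nsmul_eq_mul, mul_one]
    rw [← Set.ncard_eq_toFinset_card]
    rfl
  have hc0 : (Nat.card D : ℂ) ≠ 0 := by
    intro h
    rw [h, mul_zero] at hcard
    exact pow_ne_zero _ hp0 hcard.symm
  have h := hS X Y
  rw [← hcard, mul_assoc] at h
  have h' := mul_left_cancel₀ (pow_ne_zero _ hp0) h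
  rw [h', one_div, inv_mul_cancel_left₀ hc0]
end
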